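/- Assume τ := sup_{z∈B_Δ} |(log g′)′(z)| < 1/9, and let n be such that Mₙ < Δ/2. Let x₀ ∈ ℝ, 0 < y₀ < 1, and z₀ = x₀ + i·|mₙ(x₀)|·y₀ (a point of the upper half-plane ℍ). Then for every 0 ≤ j ≤ q_{n+1}, g^j(z₀) lies in ℍ and d_P(g^j(z₀), g^j(x₀) + i·|mₙ(g^j(x₀))|·y₀) ≤ 3, where d_P is the hyperbolic (Poincaré) distance on the upper half-plane ℍ = {z ∈ ℂ : Im z > 0}. -/

import Mathlib

open Filter Topology

/-- Gauss-map orbit of `α`: `α₀ = α`, `αₙ₊₁ = 1 / fract(αₙ)`. -/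
noncomputable def cfGauss (α : ℝ) : ℕ → ℝ
  | 0 => α
  | n + 1 => (Int.fract (cfGauss α n))⁻¹

/-- Partial quotients `aₙ` of the continued fraction of `α`. -/
noncomputable def cfA (α : ℝ) (n : ℕ) : ℤ := ⌊cfGauss α n⌋

/-- Numerators `pₙ` of the convergents of `α`. -/
noncomputable def cfP (α : ℝ) : ℕ → ℤ
  | 0 => cfA α 0
  | 1 => cfA α 1 * cfA α 0 + 1
  | n + 2 => cfA α (n + 2) * cfP α (n + 1) + cfP α n

/-- Denominators `qₙ` of the convergents of `α` (as natural numbers). -/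
noncomputable def cfQ (α : ℝ) : ℕ → ℕ
  | 0 => 1
  | 1 => (cfA α 1).toNat
  | n + 2 => (cfA α (n + 2)).toNat * cfQ α (n + 1) + cfQ α n

/-- `gₙ(x) = g^{qₙ}(x) − pₙ`. -/
noncomputable def cfIter (g : ℝ → ℝ) (α : ℝ) (n : ℕ) (x : ℝ) : ℝ :=
  g^[cfQ α n] x - cfP α n

theorem aux_irr {α : ℝ} (hα : Irrational α) : ∀ n, Irrational (cfGauss α n)
  | 0 => hα
  | n + 1 => by
    have h := aux_irr hα n
    show Irrational (Int.fract (cfGauss α n))⁻¹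
    rw [irrational_inv_iff]
    unfold Int.fract
    exact h.sub_intCast _

theorem aux_fract_pos {α : ℝ} (hα : Irrational α) (n : ℕ) : 0 < Int.fract (cfGauss α n) := by
  have h := aux_irr hα n
  rcases (Int.fract_nonneg (cfGauss α n)).lt_or_eq with h1 | h1
  · exact h1
  · exfalso
    have h2 : Irrational (Int.fract (cfGauss α n)) := by
      unfold Int.fract
      exact h.sub_intCast _
    exact h2.ne_zero h1.symm

theorem aux_gauss_gt {α : ℝ} (hα : Irrational α) (n : ℕ) : 1 < cfGauss α (n + 1) := by
  show 1 < (Int.fract (cfGauss α n))⁻¹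
  exact (one_lt_inv₀ (aux_fract_pos hα n)).2 (Int.fract_lt_one _)

theorem aux_a_pos {α : ℝ} (hα : Irrational α) (n : ℕ) : 1 ≤ cfA α (n + 1) := by
  unfold cfA
  rw [Int.le_floor]
  exact_mod_cast (aux_gauss_gt hα n).le

theorem aux_q_pos {α : ℝ} (hα : Irrational α) : ∀ n, 0 < cfQ α n
  | 0 => by simp [cfQ]
  | 1 => by
    have := aux_a_pos hα 0
    simp only [cfQ]
    simp only [zero_add] at this
    omega
  | n + 2 => by
    have := aux_q_pos hα n
    simp only [cfQ]
    positivity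

theorem aux_toNat {α : ℝ} (hα : Irrational α) (n : ℕ) :
    (((cfA α (n + 1)).toNat : ℕ) : ℤ) = cfA α (n + 1) :=
  Int.toNat_of_nonneg (by linarith [aux_a_pos hα n])

theorem aux_det {α : ℝ} (hα : Irrational α) (n : ℕ) :
    (cfQ α n : ℤ) * cfP α (n + 1) - cfP α n * cfQ α (n + 1) = (-1) ^ n := by
  induction n with
  | zero =>
    simp only [cfQ, cfP]
    have := aux_toNat hα 0
    simp only [zero_add] at this ⊢
    rw [this]; simp; ring
  | succ n ih =>
    simp only [cfQ, cfP]
    push_cast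
    have h : (((cfA α (n + 2)).toNat : ℕ) : ℤ) = cfA α (n + 2) := aux_toNat hα (n + 1)
    rw [h, pow_succ, ← ih]; ring

noncomputable def auxE (α : ℝ) (n : ℕ) : ℝ := cfQ α n * α - cfP α n

theorem aux_E_rec {α : ℝ} (hα : Irrational α) (n : ℕ) :
    auxE α n = - auxE α (n + 1) * cfGauss α (n + 2) := by
  induction n with
  | zero =>
    have h0 := aux_fract_pos hα 0
    have h1 := aux_fract_pos hα 1
    have ha := aux_toNat hα 0
    simp only [zero_add] at ha
    have ha' : (((cfA α 1).toNat : ℕ) : ℝ) = (cfA α 1 : ℝ) := by exact_mod_cast ha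
    have e1 : cfGauss α 1 = (Int.fract (cfGauss α 0))⁻¹ := rfl
    have e2 : cfGauss α 2 = (Int.fract (cfGauss α 1))⁻¹ := rfl
    have e3 : (cfA α 1 : ℝ) = cfGauss α 1 - Int.fract (cfGauss α 1) := by
      unfold cfA Int.fract; ring
    have e4 : (cfA α 0 : ℝ) = α - Int.fract (cfGauss α 0) := by
      unfold cfA Int.fract; simp [cfGauss]
    simp only [auxE, cfQ, cfP, zero_add]
    push_cast
    rw [ha', e2, e4, e3]
    generalize Int.fract (cfGauss α 1) = f1 at *
    rw [e1]
    generalize Int.fract (cfGauss α 0) = f0 at *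
    field_simp
    ring
  | succ n ih =>
    have h1 := aux_fract_pos hα (n + 2)
    have ha := aux_toNat hα (n + 1)
    have ha' : (((cfA α (n + 2)).toNat : ℕ) : ℝ) = (cfA α (n + 2) : ℝ) := by exact_mod_cast ha
    have e2 : cfGauss α (n + 3) = (Int.fract (cfGauss α (n + 2)))⁻¹ := rfl
    have e3 : (cfA α (n + 2) : ℝ) = cfGauss α (n + 2) - Int.fract (cfGauss α (n + 2)) := by
      unfold cfA Int.fract; ring
    have e5 : auxE α (n + 2) = cfA α (n + 2) * auxE α (n + 1) + auxE α n := by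
      simp only [auxE, cfQ, cfP]
      push_cast
      rw [ha']; ring
    show auxE α (n + 1) = - auxE α (n + 2) * cfGauss α (n + 3)
    rw [e5, ih, e3, e2]
    field_simp
    ring

theorem aux_E_ne {α : ℝ} (hα : Irrational α) (n : ℕ) : auxE α n ≠ 0 := by
  unfold auxE
  have h : Irrational ((cfQ α n : ℝ) * α - (cfP α n : ℝ)) :=
    (hα.natCast_mul (aux_q_pos hα n).ne').sub_intCast _
  exact h.ne_zero

/-- best approximation -/
theorem aux_best {α : ℝ} (hα : Irrational α) (n : ℕ) (l k : ℤ)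
    (hl : |l| < cfQ α (n + 1)) (hlk : l ≠ 0 ∨ k ≠ 0) :
    |auxE α n| ≤ |l * α - k| := by
  have hdet := aux_det hα n
  have hrec := aux_E_rec hα n
  have hgt := aux_gauss_gt hα (n + 1)
  have hEne := aux_E_ne hα (n + 1)
  have hq := aux_q_pos hα n
  have hq1 := aux_q_pos hα (n + 1)
  obtain ⟨x, y, hx, hy⟩ : ∃ x y : ℤ, l = x * cfQ α n + y * cfQ α (n + 1) ∧
      k = x * cfP α n + y * cfP α (n + 1) := by
    have hs : ((-1 : ℤ) ^ n) * (-1) ^ n = 1 := by rw [← mul_pow]; simp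
    refine ⟨(-1) ^ n * (l * cfP α (n + 1) - k * cfQ α (n + 1)),
      (-1) ^ n * (k * cfQ α n - l * cfP α n), ?_, ?_⟩
    · linear_combination (-l) * hs - (-1) ^ n * l * hdet
    · linear_combination (-k) * hs - (-1) ^ n * k * hdet
  have hval : (l : ℝ) * α - k = x * auxE α n + y * auxE α (n + 1) := by
    rw [hx, hy]; unfold auxE; push_cast; ring
  rw [hval]
  have hxy : x * y ≤ 0 := by
    by_contra hcon
    push Not at hcon
    have hqz : (0 : ℤ) < cfQ α n := by exact_mod_cast hq
    have hqz1 : (0 : ℤ) < cfQ α (n + 1) := by exact_mod_cast hq1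
    rw [abs_lt] at hl
    rcases pos_and_pos_or_neg_and_neg_of_mul_pos hcon with ⟨h1, h2⟩ | ⟨h1, h2⟩
    · nlinarith
    · nlinarith
  have hx0 : x ≠ 0 := by
    rintro rfl
    simp only [zero_mul, zero_add] at hx hy
    have : y ≠ 0 := by rintro rfl; simp [hx, hy] at hlk
    rw [hx, abs_mul] at hl
    have h1 : 1 ≤ |y| := Int.one_le_abs this
    have hqz1 : (0 : ℤ) < cfQ α (n + 1) := by exact_mod_cast hq1
    rw [abs_of_pos hqz1] at hl
    nlinarith
  have hxyR : (x : ℝ) * y ≤ 0 := by exact_mod_cast hxy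
  have h1 : (1 : ℝ) ≤ |(x : ℝ)| := by exact_mod_cast Int.one_le_abs hx0
  have h1' : (1 : ℝ) ≤ (x : ℝ) ^ 2 := by rw [← sq_abs]; nlinarith
  rw [← sq_le_sq]
  have hee : auxE α n * auxE α (n + 1) ≤ 0 := by
    rw [hrec]; nlinarith [sq_nonneg (auxE α (n + 1))]
  have h2 : 0 ≤ ((x : ℝ) * y) * (auxE α n * auxE α (n + 1)) := by nlinarith
  nlinarith [sq_nonneg ((y : ℝ) * auxE α (n + 1)), sq_nonneg (auxE α n)]

theorem aux_pack (N : ℕ) (hN : 0 < N) (u v a : ℕ → ℝ) (e : ℝ)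
    (huv : ∀ i < N, u i ≤ v i)
    (hord : ∀ i < N, ∀ j < N, ∀ k : ℤ, a i + e ≤ a j + k → v i ≤ u j + k)
    (hsep : ∀ i < N, ∀ j < N, ∀ k : ℤ, (i ≠ j ∨ k ≠ 0) → e ≤ |a i - a j - k|) :
    ∑ i ∈ Finset.range N, (v i - u i) ≤ 1 := by
  set K : ℕ → ℤ := fun i => -⌊a i - a 0⌋ with hK
  have hK0 : K 0 = 0 := by simp [hK]
  have hKl : ∀ i, a 0 ≤ a i + K i := fun i => by
    have := Int.floor_le (a i - a 0); simp only [hK]; push_cast; linarith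
  have hKr : ∀ i, a i + K i < a 0 + 1 := fun i => by
    have := Int.lt_floor_add_one (a i - a 0); simp only [hK]; push_cast; linarith
  have hord' : ∀ i < N, ∀ j < N, ∀ k l : ℤ, (i ≠ j ∨ k ≠ l) → a i + k ≤ a j + l →
      v i + k ≤ u j + l := by
    intro i hi j hj k l hne hle
    have h1 := hsep i hi j hj (l - k) (by
      rcases hne with h | h
      · exact Or.inl h
      · right; omega)
    push_cast at h1
    rw [abs_of_nonpos (by linarith)] at h1
    have h2 := hord i hi j hj (l - k) (by push_cast; linarith)
    push_cast at h2; linarith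
  have hsub : ∀ i < N, Set.Ioc (u i + K i) (v i + K i) ⊆ Set.Ioc (u 0) (u 0 + 1) := by
    intro i hi
    apply Set.Ioc_subset_Ioc
    · by_cases h0 : i = 0
      · subst h0; simp [hK0]
      · have := hord' 0 hN i hi 0 (K i) (Or.inl (Ne.symm h0)) (by simpa using hKl i)
        have h2 := huv 0 hN
        push_cast at this; linarith
    · have := hord' i hi 0 hN (K i) 1 (by
        by_cases h0 : i = 0
        · subst h0; right; simp [hK0]
        · exact Or.inl h0) (by have := hKr i; push_cast; linarith)
      push_cast at this; exact this
  have hdisj : Set.PairwiseDisjoint (↑(Finset.range N) : Set ℕ)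
      (fun i => Set.Ioc (u i + K i) (v i + K i)) := by
    intro i hi j hj hij
    simp only [Finset.coe_range, Set.mem_Iio] at hi hj
    rw [Function.onFun, Set.disjoint_left]
    rintro t ⟨h1, h2⟩ ⟨h3, h4⟩
    rcases le_total (a i + K i) (a j + K j) with h | h
    · have := hord' i hi j hj _ _ (Or.inl hij) h; linarith
    · have := hord' j hj i hi _ _ (Or.inl hij.symm) h; linarith
  have hmeas := MeasureTheory.measure_biUnion_finset (μ := MeasureTheory.volume) hdisj
    (fun i _ => measurableSet_Ioc)
  have hle : MeasureTheory.volume (⋃ i ∈ Finset.range N, Set.Ioc (u i + K i) (v i + K i))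
      ≤ MeasureTheory.volume (Set.Ioc (u 0) (u 0 + 1)) := by
    apply MeasureTheory.measure_mono
    apply Set.iUnion₂_subset
    intro i hi
    exact hsub i (Finset.mem_range.1 hi)
  rw [hmeas] at hle
  simp only [Real.volume_Ioc, add_sub_cancel_left, add_sub_add_right_eq_sub] at hle
  rw [← ENNReal.ofReal_sum_of_nonneg] at hle
  · exact (ENNReal.ofReal_le_ofReal_iff (by norm_num)).1 hle
  · intro i hi; have := huv i (Finset.mem_range.1 hi); linarith

section dyn
variable {g : ℝ → ℝ} {α : ℝ}

theorem aux_order_lt (hgmono : StrictMono g)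
    (hgper : ∀ x : ℝ, g (x + 1) = g x + 1)
    (hrot : ∀ x : ℝ, Tendsto (fun m : ℕ => (g^[m] x - x) / m) atTop (𝓝 α))
    (a b : ℕ) (k : ℤ) (h : a * α < b * α + k) (x : ℝ) : g^[a] x < g^[b] x + k := by
  let F : CircleDeg1Lift := ⟨⟨g, hgmono.monotone⟩, hgper⟩
  have hF : ∀ n, ⇑(F ^ n) = g^[n] := fun n => CircleDeg1Lift.coe_pow F n
  have hτ : CircleDeg1Lift.translationNumber F = α := by
    have h1 := F.tendsto_translationNumber 0
    simp only [hF] at h1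
    exact tendsto_nhds_unique h1 (hrot 0)
  rcases le_total b a with hab | hab
  · obtain ⟨c, rfl⟩ := Nat.exists_eq_add_of_le hab
    have h1 : CircleDeg1Lift.translationNumber (F ^ c) < k := by
      rw [CircleDeg1Lift.translationNumber_pow, hτ]
      push_cast at h; linarith
    have h2 := (F ^ c).map_lt_of_translationNumber_lt_int h1 (g^[b] x)
    rw [hF] at h2
    rw [add_comm b c, Function.iterate_add_apply]
    exact h2
  · obtain ⟨c, rfl⟩ := Nat.exists_eq_add_of_le hab
    have h1 : ((-k : ℤ) : ℝ) < CircleDeg1Lift.translationNumber (F ^ c) := by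
      rw [CircleDeg1Lift.translationNumber_pow, hτ]
      push_cast at h ⊢; linarith
    have h2 := (F ^ c).lt_map_of_int_lt_translationNumber h1 (g^[a] x)
    rw [hF] at h2
    rw [add_comm a c, Function.iterate_add_apply]
    push_cast at h2; linarith

theorem aux_order_le (hgmono : StrictMono g)
    (hgper : ∀ x : ℝ, g (x + 1) = g x + 1) (hα : Irrational α)
    (hrot : ∀ x : ℝ, Tendsto (fun m : ℕ => (g^[m] x - x) / m) atTop (𝓝 α))
    (a b : ℕ) (k : ℤ) (h : a * α ≤ b * α + k) (x : ℝ) : g^[a] x ≤ g^[b] x + k := by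
  rcases h.lt_or_eq with h | h
  · exact (aux_order_lt hgmono hgper hrot a b k h x).le
  · by_cases hab : a = b
    · subst hab
      have : (k : ℝ) = 0 := by linarith
      rw [this]; simp
    · exfalso
      have hne : (a : ℤ) - b ≠ 0 := by omega
      have h1 : Irrational ((((a : ℤ) - b : ℤ) : ℝ) * α - (k : ℝ)) :=
        (hα.intCast_mul hne).sub_intCast _
      apply h1.ne_zero
      push_cast; linarith

theorem aux_sum (hgmono : StrictMono g)
    (hgper : ∀ x : ℝ, g (x + 1) = g x + 1) (hα : Irrational α)
    (hrot : ∀ x : ℝ, Tendsto (fun m : ℕ => (g^[m] x - x) / m) atTop (𝓝 α))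
    (n : ℕ) (x : ℝ) :
    ∑ i ∈ Finset.range (cfQ α (n + 1)), |cfIter g α n (g^[i] x) - g^[i] x| ≤ 1 := by
  have hit : ∀ i, cfIter g α n (g^[i] x) = g^[cfQ α n + i] x - cfP α n := fun i => by
    unfold cfIter; rw [Function.iterate_add_apply]
  have hbest := aux_best hα n
  have hEdef : auxE α n = cfQ α n * α - cfP α n := rfl
  have hsep0 : ∀ i < cfQ α (n + 1), ∀ j < cfQ α (n + 1), ∀ k : ℤ, (i ≠ j ∨ k ≠ 0) →
      |auxE α n| ≤ |i * α - j * α - k| := by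
    intro i hi j hj k hne
    have := hbest ((i : ℤ) - j) k (by rw [abs_lt]; constructor <;> omega) (by
      rcases hne with h | h
      · left; omega
      · exact Or.inr h)
    push_cast at this
    rwa [sub_mul] at this
  rcases (aux_E_ne hα n).lt_or_gt with hE | hE
  · rw [abs_of_neg hE] at hsep0
    have hlt : ∀ i, cfIter g α n (g^[i] x) < g^[i] x := fun i => by
      have := aux_order_lt hgmono hgper hrot (cfQ α n + i) i (cfP α n)
        (by push_cast; linarith) x
      rw [hit]; linarith
    have := aux_pack (cfQ α (n + 1)) (aux_q_pos hα _) (fun i => cfIter g α n (g^[i] x))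
      (fun i => g^[i] x) (fun i => (cfQ α n + i) * α - cfP α n) (- auxE α n)
      (fun i _ => (hlt i).le) (by
        intro i _ j _ k h
        have := aux_order_le hgmono hgper hα hrot i (cfQ α n + j) (k - cfP α n)
          (by push_cast; linarith) x
        push_cast at this
        show g^[i] x ≤ cfIter g α n (g^[j] x) + k
        rw [hit]; linarith)
      (by
        intro i hi j hj k h
        refine (hsep0 i hi j hj k h).trans (le_of_eq ?_)
        congr 1; ring)
    refine (le_of_eq (Finset.sum_congr rfl fun i _ => ?_)).trans this
    rw [abs_of_neg (by linarith [hlt i])]; ring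
  · rw [abs_of_pos hE] at hsep0
    have hlt : ∀ i, g^[i] x < cfIter g α n (g^[i] x) := fun i => by
      have := aux_order_lt hgmono hgper hrot i (cfQ α n + i) (-cfP α n)
        (by push_cast; linarith) x
      push_cast at this
      rw [hit]; linarith
    have := aux_pack (cfQ α (n + 1)) (aux_q_pos hα _) (fun i => g^[i] x)
      (fun i => cfIter g α n (g^[i] x)) (fun i => i * α) (auxE α n)
      (fun i _ => (hlt i).le) (by
        intro i _ j _ k h
        have := aux_order_le hgmono hgper hα hrot (cfQ α n + i) j (k + cfP α n)
          (by push_cast; linarith) x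
        push_cast at this
        show cfIter g α n (g^[i] x) ≤ g^[j] x + k
        rw [hit]; linarith)
      hsep0
    refine (le_of_eq (Finset.sum_congr rfl fun i _ => ?_)).trans this
    rw [abs_of_pos (by linarith [hlt i])]

theorem aux_iter_ne (hgmono : StrictMono g)
    (hgper : ∀ x : ℝ, g (x + 1) = g x + 1) (hα : Irrational α)
    (hrot : ∀ x : ℝ, Tendsto (fun m : ℕ => (g^[m] x - x) / m) atTop (𝓝 α))
    (n : ℕ) (x : ℝ) : 0 < |cfIter g α n x - x| := by
  have hEdef : auxE α n = cfQ α n * α - cfP α n := rfl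
  rw [abs_pos]
  unfold cfIter
  rcases (aux_E_ne hα n).lt_or_gt with hE | hE
  · have := aux_order_lt hgmono hgper hrot (cfQ α n) 0 (cfP α n) (by push_cast; linarith) x
    simp only [Function.iterate_zero, id] at this
    intro h; linarith
  · have := aux_order_lt hgmono hgper hrot 0 (cfQ α n) (-cfP α n) (by push_cast; linarith) x
    simp only [Function.iterate_zero, id] at this
    push_cast at this
    intro h; linarith

theorem aux_iter_comm (hgmono : StrictMono g)
    (hgper : ∀ x : ℝ, g (x + 1) = g x + 1) (n i : ℕ) (x : ℝ) :
    cfIter g α n (g^[i] x) = g^[i] (cfIter g α n x) := by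
  let F : CircleDeg1Lift := ⟨⟨g, hgmono.monotone⟩, hgper⟩
  have hF : ∀ n, ⇑(F ^ n) = g^[n] := fun n => CircleDeg1Lift.coe_pow F n
  unfold cfIter
  have := (F ^ i).map_sub_int (g^[cfQ α n] x) (cfP α n)
  rw [hF] at this
  rw [this, ← Function.iterate_add_apply, ← Function.iterate_add_apply, add_comm]

theorem aux_le_sup (hgmono : StrictMono g)
    (hgper : ∀ x : ℝ, g (x + 1) = g x + 1) (n : ℕ) (x : ℝ) :
    |cfIter g α n x - x| ≤ ⨆ x : ℝ, |cfIter g α n x - x| := by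
  let F : CircleDeg1Lift := ⟨⟨g, hgmono.monotone⟩, hgper⟩
  have hF : ∀ n, ⇑(F ^ n) = g^[n] := fun n => CircleDeg1Lift.coe_pow F n
  apply le_ciSup (f := fun x : ℝ => |cfIter g α n x - x|)
  refine ⟨|g^[cfQ α n] 0| + 1 + |(cfP α n : ℝ)|, ?_⟩
  rintro _ ⟨y, rfl⟩
  have h1 := (F ^ (cfQ α n)).map_fract_sub_fract_eq y
  have h2 := (F ^ (cfQ α n)).monotone (Int.fract_nonneg y)
  have h3 := (F ^ (cfQ α n)).monotone (Int.fract_lt_one y).le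
  have h4 := (F ^ (cfQ α n)).map_add_one 0
  rw [zero_add] at h4
  rw [h4] at h3
  rw [hF] at h1 h2 h3
  have h5 := Int.fract_nonneg y
  have h6 := (Int.fract_lt_one y).le
  show |g^[cfQ α n] y - cfP α n - y| ≤ _
  rw [show g^[cfQ α n] y - cfP α n - y = (g^[cfQ α n] y - y) - cfP α n by ring, ← h1]
  refine (abs_sub _ _).trans ?_
  gcongr
  rw [abs_le]
  constructor
  · linarith [neg_abs_le (g^[cfQ α n] 0)]
  · linarith [le_abs_self (g^[cfQ α n] 0)]

end dyn

section cplx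
variable {Δ τ : ℝ} {G : ℂ → ℂ}

theorem aux_convex : Convex ℝ {z : ℂ | |z.im| < Δ} := by
  have : {z : ℂ | |z.im| < Δ} = Complex.imLm ⁻¹' (Set.Ioo (-Δ) Δ) := by
    ext z; simp [abs_lt]
  rw [this]
  exact (convex_Ioo _ _).linear_preimage _

theorem aux_open : IsOpen {z : ℂ | |z.im| < Δ} :=
  isOpen_lt (by fun_prop) continuous_const

theorem aux_log (hd : DifferentiableOn ℂ G {z : ℂ | |z.im| < Δ})
    (hRe : ∀ z : ℂ, |z.im| < Δ → 0 < (deriv G z).re)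
    (hτ : ∀ z : ℂ, |z.im| < Δ → ‖iteratedDeriv 2 G z / deriv G z‖ ≤ τ)
    {z w : ℂ} (hz : |z.im| < Δ) (hw : |w.im| < Δ) :
    ∃ δ : ℂ, ‖δ‖ ≤ τ * ‖z - w‖ ∧ deriv G z = deriv G w * Complex.exp δ := by
  refine ⟨Complex.log (deriv G z) - Complex.log (deriv G w), ?_, ?_⟩
  · refine aux_convex.norm_image_sub_le_of_norm_hasDerivWithin_le
      (f := fun z => Complex.log (deriv G z))
      (f' := fun z => iteratedDeriv 2 G z / deriv G z)
      (s := {z : ℂ | |z.im| < Δ}) ?_ hτ hw hz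
    intro u hu
    have h1 : HasDerivAt (deriv G) (iteratedDeriv 2 G u) u := by
      have := (hd.deriv aux_open).differentiableAt (aux_open.mem_nhds hu)
      have h2 := this.hasDerivAt
      rwa [show deriv (deriv G) u = iteratedDeriv 2 G u by
        rw [iteratedDeriv_succ, iteratedDeriv_one]] at h2
    exact (h1.clog (Or.inl (hRe u hu))).hasDerivWithinAt
  · have hn : ∀ u : ℂ, |u.im| < Δ → deriv G u ≠ 0 := fun u hu h => by
      have := hRe u hu; rw [h] at this; simp at this
    rw [Complex.exp_sub, Complex.exp_log (hn z hz), Complex.exp_log (hn w hw)]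
    field_simp [hn w hw]

theorem aux_deriv (hd : DifferentiableOn ℂ G {z : ℂ | |z.im| < Δ})
    (hRe : ∀ z : ℂ, |z.im| < Δ → 0 < (deriv G z).re)
    (hτ : ∀ z : ℂ, |z.im| < Δ → ‖iteratedDeriv 2 G z / deriv G z‖ ≤ τ) (hτ0 : 0 ≤ τ)
    (m : ℕ → ℝ) (x z : ℂ) (j : ℕ)
    (h : ∀ i < j, |(G^[i] x).im| < Δ ∧ |(G^[i] z).im| < Δ ∧ ‖G^[i] z - G^[i] x‖ ≤ m i) :
    ∃ δ : ℂ, ‖δ‖ ≤ τ * ∑ i ∈ Finset.range j, m i ∧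
      HasDerivAt (G^[j]) ((∏ i ∈ Finset.range j, deriv G (G^[i] x)) * Complex.exp δ) z := by
  induction j with
  | zero => exact ⟨0, by simp, by simpa using hasDerivAt_id z⟩
  | succ j ih =>
    obtain ⟨δ, h1, h2⟩ := ih fun i hi => h i (by omega)
    obtain ⟨hx, hz, hm⟩ := h j (by omega)
    obtain ⟨δ', h3, h4⟩ := aux_log hd hRe hτ hz hx
    refine ⟨δ' + δ, ?_, ?_⟩
    · rw [Finset.sum_range_succ, mul_add]
      have := mul_le_mul_of_nonneg_left hm hτ0
      linarith [norm_add_le δ' δ]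
    · rw [Function.iterate_succ', Finset.prod_range_succ, Complex.exp_add]
      have h5 := (hd.differentiableAt (aux_open.mem_nhds hz)).hasDerivAt
      have h6 := h5.comp z h2
      have e : (∏ i ∈ Finset.range j, deriv G (G^[i] x)) * deriv G (G^[j] x) *
          (Complex.exp δ' * Complex.exp δ) = deriv G (G^[j] z) *
          ((∏ i ∈ Finset.range j, deriv G (G^[i] x)) * Complex.exp δ) := by
        rw [h4]; ring
      rw [e]
      exact h6

theorem aux_mvt (hd : DifferentiableOn ℂ G {z : ℂ | |z.im| < Δ})
    (hRe : ∀ z : ℂ, |z.im| < Δ → 0 < (deriv G z).re)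
    (hτ : ∀ z : ℂ, |z.im| < Δ → ‖iteratedDeriv 2 G z / deriv G z‖ ≤ τ) (hτ0 : 0 ≤ τ)
    (m : ℕ → ℝ) (x w : ℂ) (j : ℕ) (B : ℝ) (hB : B ≤ 1)
    (hsum : τ * ∑ i ∈ Finset.range j, m i ≤ B)
    (h : ∀ z ∈ segment ℝ x w, ∀ i < j,
      |(G^[i] x).im| < Δ ∧ |(G^[i] z).im| < Δ ∧ ‖G^[i] z - G^[i] x‖ ≤ m i) :
    ‖G^[j] w - G^[j] x - (∏ i ∈ Finset.range j, deriv G (G^[i] x)) * (w - x)‖ ≤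
      2 * B * ‖∏ i ∈ Finset.range j, deriv G (G^[i] x)‖ * ‖w - x‖ := by
  set D := ∏ i ∈ Finset.range j, deriv G (G^[i] x) with hD
  have key : ∀ z ∈ segment ℝ x w, ∃ δ : ℂ, ‖δ‖ ≤ B ∧
      HasDerivAt (G^[j]) (D * Complex.exp δ) z := fun z hz => by
    obtain ⟨δ, h1, h2⟩ := aux_deriv hd hRe hτ hτ0 m x z j (h z hz)
    exact ⟨δ, h1.trans hsum, h2⟩
  have hbound : ∀ z ∈ segment ℝ x w, ‖deriv (G^[j]) z - D‖ ≤ 2 * B * ‖D‖ := fun z hz => by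
    obtain ⟨δ, h1, h2⟩ := key z hz
    rw [h2.deriv, show D * Complex.exp δ - D = D * (Complex.exp δ - 1) by ring, norm_mul]
    have := Complex.norm_exp_sub_one_le (h1.trans hB)
    nlinarith [norm_nonneg D]
  have := (convex_segment x w).norm_image_sub_le_of_norm_hasDerivWithin_le
    (f := fun z => G^[j] z - D * z) (f' := fun z => deriv (G^[j]) z - D) (C := 2 * B * ‖D‖)
    (𝕜 := ℂ) (fun z hz => by
      obtain ⟨δ, h1, h2⟩ := key z hz
      have h3 := h2.fun_sub ((hasDerivAt_id z).const_mul D)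
      rw [h2.deriv]
      simpa using h3.hasDerivWithinAt) hbound (left_mem_segment ℝ x w) (right_mem_segment ℝ x w)
  refine le_trans (le_of_eq ?_) this
  congr 1; ring

theorem aux_real {g : ℝ → ℝ} (hGreal : ∀ x : ℝ, G (x : ℂ) = ((g x : ℝ) : ℂ)) (x : ℝ)
    (hd : DifferentiableAt ℂ G x) : (deriv G x).im = 0 := by
  have h1 := hd.hasDerivAt.comp_ofReal
  have h2 : HasDerivAt (fun y : ℝ => (G y).im) (deriv G x).im x := by
    have := (Complex.imCLM.hasFDerivAt (x := G x)).comp_hasDerivAt x h1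
    simpa [Function.comp_def] using this
  have h3 : (fun y : ℝ => (G y).im) = fun _ => 0 := by
    funext y; rw [hGreal]; simp
  rw [h3] at h2
  exact h2.unique (hasDerivAt_const x 0)

end cplx

/-- **Hyperbolic Denjoy–Yoccoz Lemma.**
Let `g ∈ D^ω(𝕋,Δ)` with holomorphic extension `G` to the strip `B_Δ`, `Re G′ > 0` on `B_Δ`,
irrational rotation number `α`, and nonlinearity `τ = sup_{B_Δ} |(log g′)′| < 1/9`.  Let `n`
be such that `Mₙ < Δ/2`, `x₀ ∈ ℝ`, `0 < y₀ < 1` and `z₀ = x₀ + i |mₙ(x₀)| y₀ ∈ ℍ`.  Then for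
`0 ≤ j ≤ q_{n+1}`, `G^j(z₀) ∈ ℍ` and the hyperbolic distance from `G^j(z₀)` to
`g^j(x₀) + i |mₙ(g^j(x₀))| y₀` is at most `3`. -/
theorem hyperbolic_denjoy_yoccoz
    (Δ : ℝ) (hΔ : 0 < Δ)
    (g : ℝ → ℝ) (G : ℂ → ℂ) (V : Set ℂ)
    (hVopen : IsOpen V) (hVΔ : closure {z : ℂ | |z.im| < Δ} ⊆ V)
    (hVshift : ∀ z : ℂ, z ∈ V ↔ z + 1 ∈ V)
    (hGholo : DifferentiableOn ℂ G V) (hGinj : Set.InjOn G V)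
    (hGonto : closure {z : ℂ | |z.im| < Δ} ⊆ G '' V)
    (hGreal : ∀ x : ℝ, G (x : ℂ) = ((g x : ℝ) : ℂ))
    (hgmono : StrictMono g) (hgsurj : Function.Surjective g)
    (hgper : ∀ x : ℝ, g (x + 1) = g x + 1)
    (hGper : ∀ z ∈ V, G (z + 1) = G z + 1)
    (hRe : ∀ z : ℂ, |z.im| < Δ → 0 < (deriv G z).re)
    (α : ℝ) (hα : Irrational α)
    (hrot : ∀ x : ℝ, Tendsto (fun m : ℕ => (g^[m] x - x) / m) atTop (𝓝 α))
    (τ : ℝ) (hτsmall : τ < 1 / 9)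
    (hτ : ∀ z : ℂ, |z.im| < Δ → ‖iteratedDeriv 2 G z / deriv G z‖ ≤ τ)
    (n : ℕ) (hMn : (⨆ x : ℝ, |cfIter g α n x - x|) < Δ / 2)
    (x₀ y₀ : ℝ) (hy₀ : 0 < y₀) (hy₀1 : y₀ < 1)
    (z₀ : ℂ)
    (hz₀ : z₀ = (x₀ : ℂ) + Complex.I * ((|cfIter g α n x₀ - x₀| : ℝ) : ℂ) * (y₀ : ℂ)) :
    ∀ j ≤ cfQ α (n + 1),
      ∃ (h₁ : 0 < (G^[j] z₀).im)
        (h₂ : 0 < (((g^[j] x₀ : ℝ) : ℂ) +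
          Complex.I * ((|cfIter g α n (g^[j] x₀) - g^[j] x₀| : ℝ) : ℂ) * (y₀ : ℂ)).im),
        dist (⟨G^[j] z₀, h₁⟩ : UpperHalfPlane)
          (⟨((g^[j] x₀ : ℝ) : ℂ) +
            Complex.I * ((|cfIter g α n (g^[j] x₀) - g^[j] x₀| : ℝ) : ℂ) * (y₀ : ℂ), h₂⟩ :
            UpperHalfPlane) ≤ 3 := by
  set m : ℕ → ℝ := fun i => |cfIter g α n (g^[i] x₀) - g^[i] x₀| with hm
  set S : Set ℂ := {z : ℂ | |z.im| < Δ} with hS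
  have hd : DifferentiableOn ℂ G S := hGholo.mono (subset_closure.trans hVΔ)
  have hτ0 : 0 ≤ τ := (norm_nonneg _).trans (hτ 0 (by simpa using hΔ))
  have hmpos : ∀ i, 0 < m i := fun i => aux_iter_ne hgmono hgper hα hrot n _
  have hmlt : ∀ i, m i < Δ / 2 := fun i =>
    (aux_le_sup (α := α) hgmono hgper n (g^[i] x₀)).trans_lt hMn
  have hsum : ∀ j ≤ cfQ α (n + 1), ∑ i ∈ Finset.range j, m i ≤ 1 := fun j hj =>
    (Finset.sum_le_sum_of_subset_of_nonneg (Finset.range_mono hj)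
      fun i _ _ => (hmpos i).le).trans (aux_sum hgmono hgper hα hrot n x₀)
  have hGit : ∀ (i : ℕ) (x : ℝ), G^[i] (x : ℂ) = ((g^[i] x : ℝ) : ℂ) := by
    intro i
    induction i with
    | zero => intro x; simp
    | succ i ih => intro x; rw [Function.iterate_succ_apply, hGreal, ih,
        ← Function.iterate_succ_apply]
  have him : ∀ (i : ℕ) (x : ℝ), |(G^[i] (x : ℂ)).im| < Δ := fun i x => by
    rw [hGit]; simpa using hΔ
  -- the real multiplier
  have hDex : ∀ j : ℕ, ∃ d : ℝ, 0 < d ∧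
      ∏ i ∈ Finset.range j, deriv G (G^[i] (x₀ : ℂ)) = (d : ℂ) := by
    intro j
    induction j with
    | zero => exact ⟨1, one_pos, by simp⟩
    | succ j ih =>
      obtain ⟨d, hd0, hde⟩ := ih
      have hj := him j x₀
      refine ⟨d * (deriv G (G^[j] (x₀ : ℂ))).re, mul_pos hd0 (hRe _ hj), ?_⟩
      rw [Finset.prod_range_succ, hde, Complex.ofReal_mul]
      congr 1
      have hr : (deriv G (G^[j] (x₀ : ℂ))).im = 0 := by
        rw [hGit] at hj ⊢
        exact aux_real hGreal _ (hd.differentiableAt (aux_open.mem_nhds hj))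
      apply Complex.ext <;> simp [hr]
  choose d hdpos hdD using hDex
  -- real distortion
  have hreal : ∀ j ≤ cfQ α (n + 1), |m j - d j * m 0| ≤ 2 / 9 * (d j * m 0) := by
    intro j hj
    set x₁ := cfIter g α n x₀ with hx₁
    have hmi : ∀ i, m i = |g^[i] x₁ - g^[i] x₀| := fun i => by
      simp only [hm]; rw [aux_iter_comm hgmono hgper]
    have key := aux_mvt hd hRe hτ hτ0 m (x₀ : ℂ) (x₁ : ℂ) j (1 / 9) (by norm_num)
      (by nlinarith [hsum j hj]) (by
        intro z hz i _
        obtain ⟨a, b, ha, hb, hab, rfl⟩ := hz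
        have hz' : a • (x₀ : ℂ) + b • (x₁ : ℂ) = ((a * x₀ + b * x₁ : ℝ) : ℂ) := by
          simp
        refine ⟨him i x₀, by rw [hz']; exact him i _, ?_⟩
        rw [hz', hGit, hGit, ← Complex.ofReal_sub, Complex.norm_real, Real.norm_eq_abs, hmi]
        have ha' : a = 1 - b := by linarith
        have hmon := (hgmono.iterate i).monotone
        rcases le_total x₀ x₁ with h | h
        · have h1 : x₀ ≤ a * x₀ + b * x₁ := by rw [ha']; nlinarith
          have h2 : a * x₀ + b * x₁ ≤ x₁ := by rw [ha'] at ha ⊢; nlinarith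
          have h3 := hmon h1
          have h4 := hmon h2
          rw [abs_of_nonneg (by linarith), abs_of_nonneg (by linarith)]; linarith
        · have h1 : a * x₀ + b * x₁ ≤ x₀ := by rw [ha']; nlinarith
          have h2 : x₁ ≤ a * x₀ + b * x₁ := by rw [ha'] at ha ⊢; nlinarith
          have h3 := hmon h1
          have h4 := hmon h2
          rw [abs_of_nonpos (by linarith), abs_of_nonpos (by linarith)]; linarith)
    rw [hdD, hGit, hGit, ← Complex.ofReal_sub, ← Complex.ofReal_sub, ← Complex.ofReal_mul,
      ← Complex.ofReal_sub, Complex.norm_real, Complex.norm_real, Complex.norm_real,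
      Real.norm_eq_abs, Real.norm_eq_abs, Real.norm_eq_abs, abs_of_pos (hdpos j)] at key
    have h0 : m 0 = |x₁ - x₀| := by rw [hmi]; simp
    rw [← h0] at key
    have h5 := abs_abs_sub_abs_le (g^[j] x₁ - g^[j] x₀) (d j * (x₁ - x₀))
    rw [abs_mul, abs_of_pos (hdpos j), ← hmi, ← h0] at h5
    calc _ ≤ _ := h5
      _ ≤ _ := key
      _ = _ := by ring
  have hz0n : ‖z₀ - x₀‖ = m 0 * y₀ := by
    rw [hz₀]
    simp only [add_sub_cancel_left, norm_mul, Complex.norm_I, one_mul, Complex.norm_real,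
      Real.norm_eq_abs, abs_abs, abs_of_pos hy₀]
    simp [hm]
  -- sub-segments
  have hseg : ∀ z ∈ segment ℝ (x₀ : ℂ) z₀, ‖z - x₀‖ ≤ m 0 * y₀ ∧
      segment ℝ (x₀ : ℂ) z ⊆ segment ℝ (x₀ : ℂ) z₀ := by
    intro z hz
    refine ⟨?_, (convex_segment _ _).segment_subset (left_mem_segment _ _ _) hz⟩
    rw [← hz0n]
    have := norm_sub_le_of_mem_segment hz
    exact this
  have hmain : ∀ j ≤ cfQ α (n + 1), ∀ z ∈ segment ℝ (x₀ : ℂ) z₀,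
      ‖G^[j] z - G^[j] (x₀ : ℂ)‖ ≤ 2 * m j ∧
      ‖G^[j] z - G^[j] (x₀ : ℂ) - (d j : ℂ) * (z - x₀)‖ ≤ 4 / 9 * d j * ‖z - x₀‖ := by
    intro j
    induction j using Nat.strong_induction_on with
    | _ j ih =>
      intro hj z hz
      have key := aux_mvt hd hRe hτ hτ0 (fun i => 2 * m i) (x₀ : ℂ) z j (2 / 9) (by norm_num)
        (by rw [← Finset.mul_sum]; nlinarith [hsum j hj]) (by
          intro w hw i hi
          have h1 := (ih i hi (by omega) w ((hseg z hz).2 hw)).1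
          refine ⟨him i x₀, ?_, h1⟩
          have h2 := (Complex.abs_im_le_norm (G^[i] w - G^[i] (x₀ : ℂ))).trans h1
          have h3 := hmlt i
          rw [hGit] at h2
          simp only [Complex.sub_im, Complex.ofReal_im, sub_zero] at h2
          linarith)
      rw [hdD, Complex.norm_real, Real.norm_eq_abs, abs_of_pos (hdpos j)] at key
      have key' : ‖G^[j] z - G^[j] (x₀ : ℂ) - (d j : ℂ) * (z - x₀)‖ ≤
          4 / 9 * d j * ‖z - x₀‖ := key.trans (le_of_eq (by ring))
      refine ⟨?_, key'⟩
      have h1 := norm_le_norm_sub_add (G^[j] z - G^[j] (x₀ : ℂ)) ((d j : ℂ) * (z - x₀))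
      rw [norm_mul, Complex.norm_real, Real.norm_eq_abs, abs_of_pos (hdpos j)] at h1
      have h2 := (hseg z hz).1
      have h3 : ‖z - x₀‖ ≤ m 0 := h2.trans (by nlinarith [hmpos 0])
      have h4 := abs_le.1 (hreal j hj)
      have h5 := mul_le_mul_of_nonneg_left h3 (hdpos j).le
      have h6 := mul_pos (hdpos j) (hmpos 0)
      linarith [h4.1]
  intro j hj
  have hfin := (hmain j hj z₀ (right_mem_segment _ _ _)).2
  rw [hz0n, hGit] at hfin
  have hz0' : z₀ - x₀ = Complex.I * ((m 0 * y₀ : ℝ) : ℂ) := by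
    rw [hz₀]; simp [hm]; ring
  rw [hz0'] at hfin
  set A := d j * (m 0 * y₀) with hA
  have hApos : 0 < A := mul_pos (hdpos j) (mul_pos (hmpos 0) hy₀)
  have hfin' : ‖G^[j] z₀ - (g^[j] x₀ : ℝ) - Complex.I * (A : ℂ)‖ ≤ 4 / 9 * A := by
    refine le_trans (le_of_eq ?_) (hfin.trans (le_of_eq ?_))
    · congr 1; rw [hA]; push_cast; ring
    · rw [hA]; ring
  have hrr : |A - m j * y₀| ≤ 2 / 9 * A := by
    have h4 := abs_le.1 (hreal j hj)
    have h5 := mul_le_mul_of_nonneg_right h4.1 hy₀.le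
    have h6 := mul_le_mul_of_nonneg_right h4.2 hy₀.le
    rw [abs_le, hA]
    constructor <;> linarith
  have him1 : 5 / 9 * A ≤ (G^[j] z₀).im := by
    have := (Complex.abs_im_le_norm _).trans hfin'
    simp at this
    linarith [(abs_le.1 this).1]
  have him2e : (((g^[j] x₀ : ℝ) : ℂ) +
      Complex.I * ((|cfIter g α n (g^[j] x₀) - g^[j] x₀| : ℝ) : ℂ) * (y₀ : ℂ)).im = m j * y₀ := by
    simp [hm]
  have him2 : 7 / 9 * A ≤ m j * y₀ := by linarith [(abs_le.1 hrr).2]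
  refine ⟨by linarith, by rw [him2e]; exact mul_pos (hmpos j) hy₀, ?_⟩
  refine (UpperHalfPlane.dist_le_dist_coe_div_sqrt _ _).trans ?_
  have hsq : A / 2 ≤ √((G^[j] z₀).im * (m j * y₀)) := by
    apply Real.le_sqrt_of_sq_le
    have := mul_le_mul him1 him2 (by positivity) (by linarith)
    nlinarith [sq_nonneg A]
  have hdist : dist (G^[j] z₀) (((g^[j] x₀ : ℝ) : ℂ) +
      Complex.I * ((|cfIter g α n (g^[j] x₀) - g^[j] x₀| : ℝ) : ℂ) * (y₀ : ℂ)) ≤ 2 / 3 * A := by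
    rw [dist_eq_norm]
    have e : G^[j] z₀ - (((g^[j] x₀ : ℝ) : ℂ) +
      Complex.I * ((|cfIter g α n (g^[j] x₀) - g^[j] x₀| : ℝ) : ℂ) * (y₀ : ℂ)) =
      (G^[j] z₀ - (g^[j] x₀ : ℝ) - Complex.I * (A : ℂ)) +
        Complex.I * ((A - m j * y₀ : ℝ) : ℂ) := by
      simp only [hm]; push_cast; ring
    rw [e]
    refine (norm_add_le _ _).trans ?_
    rw [norm_mul, Complex.norm_I, one_mul, Complex.norm_real, Real.norm_eq_abs]
    linarith
  have hgoal : dist (G^[j] z₀) (((g^[j] x₀ : ℝ) : ℂ) +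
      Complex.I * ((|cfIter g α n (g^[j] x₀) - g^[j] x₀| : ℝ) : ℂ) * (y₀ : ℂ)) /
      √((G^[j] z₀).im * (((g^[j] x₀ : ℝ) : ℂ) +
      Complex.I * ((|cfIter g α n (g^[j] x₀) - g^[j] x₀| : ℝ) : ℂ) * (y₀ : ℂ)).im) ≤ 3 := by
    rw [him2e, div_le_iff₀ (by linarith)]
    linarith
  exact hgoal
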